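/- arXiv:1911.07212 — 4 statements merged into one kernel-verified Lean document; each statement's English description precedes it below -/
import Mathlib

section
/- Every nonzero element of the additive code C_4^9 has Hamming weight (number of nonzero coordinates) at least 4, and some element of C_4^9 has Hamming weight exactly 4; that is, the minimum distance of C_4^9 is 4. -/
open Matrix
open scoped Classical

noncomputable section

abbrev F4 := GaloisField 2 2
abbrev F2 := ZMod 2

/-- Hamming weight: number of nonzero coordinates. -/
def wt {n : ℕ} {α : Type*} [Zero α] (v : Fin n → α) : ℕ :=
  Nat.card {i : Fin n // v i ≠ 0}

def r1 (ω : F4) : Fin 9 → F4 := ![1, 0, 0, 0, 0, ω + 1, 1, 1, 1]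
def r2 (ω : F4) : Fin 9 → F4 := ![ω, 0, 0, 0, 0, 1, ω, ω, ω]
def r3 (ω : F4) : Fin 9 → F4 := ![0, 1, 0, 0, 0, 1, ω, ω + 1, 0]
def r4 (ω : F4) : Fin 9 → F4 := ![0, ω, 0, 0, 0, ω, ω + 1, 1, 0]
def r5 (ω : F4) : Fin 9 → F4 := ![0, 0, 1, 0, 0, 0, 1, ω, ω + 1]
def r6 (ω : F4) : Fin 9 → F4 := ![0, 0, ω, 0, 0, 0, ω, ω + 1, 1]
def r7 (ω : F4) : Fin 9 → F4 := ![0, 0, 0, 1, 0, ω + 1, ω + 1, 0, 1]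
def r8 (ω : F4) : Fin 9 → F4 := ![0, 0, 0, ω, 0, 1, 1, 0, ω]
def r9 (ω : F4) : Fin 9 → F4 := ![0, 0, 0, 0, 1, 1, ω, 1, 1]
def r10 (ω : F4) : Fin 9 → F4 := ![0, 0, 0, 0, ω, ω, ω + 1, ω, ω]

/-- The additive code C₄⁹: the GF(2)-linear span of r1, …, r10 in GF(4)⁹. -/
def C49 (ω : F4) : Submodule F2 (Fin 9 → F4) :=
  Submodule.span F2 (Set.range ![r1 ω, r2 ω, r3 ω, r4 ω, r5 ω, r6 ω, r7 ω, r8 ω, r9 ω, r10 ω])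

/-- The generators of `C49`, with `a + b * ω` written as the pair `(a, b)`. -/
def pairGenerators : Fin 10 → Fin 9 → F2 × F2 :=
  ![![(1, 0), 0, 0, 0, 0, (1, 1), (1, 0), (1, 0), (1, 0)],
    ![(0, 1), 0, 0, 0, 0, (1, 0), (0, 1), (0, 1), (0, 1)],
    ![0, (1, 0), 0, 0, 0, (1, 0), (0, 1), (1, 1), 0],
    ![0, (0, 1), 0, 0, 0, (0, 1), (1, 1), (1, 0), 0],
    ![0, 0, (1, 0), 0, 0, 0, (1, 0), (0, 1), (1, 1)],
    ![0, 0, (0, 1), 0, 0, 0, (0, 1), (1, 1), (1, 0)],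
    ![0, 0, 0, (1, 0), 0, (1, 1), (1, 1), 0, (1, 0)],
    ![0, 0, 0, (0, 1), 0, (1, 0), (1, 0), 0, (0, 1)],
    ![0, 0, 0, 0, (1, 0), (1, 0), (0, 1), (1, 0), (1, 0)],
    ![0, 0, 0, 0, (0, 1), (0, 1), (1, 1), (0, 1), (0, 1)]]

/-- The `F2`-linear map `(a, b) ↦ a + b * ω`. -/
def pairToF4 (ω : F4) : F2 × F2 →ₗ[F2] F4 :=
  (LinearMap.toSpanSingleton F2 F4 1).coprod (LinearMap.toSpanSingleton F2 F4 ω)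

lemma pairToF4_apply (ω : F4) (p : F2 × F2) : pairToF4 ω p = p.1 • 1 + p.2 • ω := by
  simp [pairToF4]

lemma pairToF4_injective {ω : F4} (hω : ω ^ 2 = ω + 1) :
    Function.Injective (pairToF4 ω) := by
  have h0 : ω ≠ 0 := by
    rintro rfl
    simp at hω
  have h1 : 1 + ω ≠ 0 := by
    intro h
    rw [add_comm, ← hω] at h
    exact h0 (pow_eq_zero_iff two_ne_zero |>.mp h)
  rw [injective_iff_map_eq_zero]
  rintro ⟨a, b⟩ h
  rw [pairToF4_apply] at h
  have zero_or_one : ∀ x : F2, x = 0 ∨ x = 1 := by decide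
  rcases zero_or_one a with rfl | rfl <;> rcases zero_or_one b with rfl | rfl <;> simp_all

lemma pairToF4_comp_pairGenerators (ω : F4) (j : Fin 10) :
    pairToF4 ω ∘ pairGenerators j =
      ![r1 ω, r2 ω, r3 ω, r4 ω, r5 ω, r6 ω, r7 ω, r8 ω, r9 ω, r10 ω] j := by
  funext i
  fin_cases j <;> fin_cases i <;>
    simp [pairToF4_apply, pairGenerators, r1, r2, r3, r4, r5, r6, r7, r8, r9, r10, add_comm]

lemma eq_zero_or_four_le_hammingNorm_pairGenerators (c : Fin 10 → F2) :
    ∑ j, c j • pairGenerators j = 0 ∨ 4 ≤ hammingNorm (∑ j, c j • pairGenerators j) := by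
  revert c
  decide +kernel

lemma wt_eq_hammingNorm {n : ℕ} {α : Type*} [Zero α] [DecidableEq α] (v : Fin n → α) :
    wt v = hammingNorm v := by
  rw [wt, Nat.card_eq_fintype_card, Fintype.card_subtype, hammingNorm]

lemma wt_pairToF4_comp {ω : F4} (hω : ω ^ 2 = ω + 1) {n : ℕ} (u : Fin n → F2 × F2) :
    wt (pairToF4 ω ∘ u) = hammingNorm u := by
  rw [wt_eq_hammingNorm]
  exact hammingNorm_comp (fun _ => pairToF4 ω) (fun _ => pairToF4_injective hω)
    (fun _ => map_zero _)

theorem stmt1 (ω : F4) (hω : ω ^ 2 = ω + 1) :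
    (∀ v ∈ C49 ω, v ≠ 0 → 4 ≤ wt v) ∧ (∃ v ∈ C49 ω, wt v = 4) := by
  constructor
  · intro v hv hv0
    obtain ⟨c, rfl⟩ := (Submodule.mem_span_range_iff_exists_fun F2).mp hv
    have hc : ∑ j, c j • ![r1 ω, r2 ω, r3 ω, r4 ω, r5 ω, r6 ω, r7 ω, r8 ω, r9 ω, r10 ω] j =
        pairToF4 ω ∘ ∑ j, c j • pairGenerators j := by
      funext i
      simp only [← pairToF4_comp_pairGenerators, Finset.sum_apply, Pi.smul_apply,
        Function.comp_apply, map_sum, map_smul]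
    rw [hc] at hv0 ⊢
    rw [wt_pairToF4_comp hω]
    refine (eq_zero_or_four_le_hammingNorm_pairGenerators c).resolve_left fun h => hv0 ?_
    funext i
    simp [h]
  · refine ⟨r3 ω, Submodule.subset_span ⟨2, rfl⟩, ?_⟩
    have h := pairToF4_comp_pairGenerators ω 2
    change _ = r3 ω at h
    rw [← h, wt_pairToF4_comp hω]
    decide +kernel
end
end

section
/- The weight distribution of the additive code C_4^9 is: the number of elements of Hamming weight w equals 1 for w=0, 51 for w=4, 135 for w=5, 210 for w=6, 318 for w=7, 234 for w=8, 75 for w=9, and 0 for all other w. -/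
open Matrix
open scoped Classical

noncomputable section

/-- The `𝔽₂`-linear map `(a, b) ↦ a + b ω` giving coordinates on `F4`. -/
def coordMap (ω : F4) : F2 × F2 →ₗ[F2] F4 :=
  (LinearMap.toSpanSingleton F2 F4 1).coprod (LinearMap.toSpanSingleton F2 F4 ω)

lemma coordMap_apply (ω : F4) (x : F2 × F2) : coordMap ω x = x.1 • 1 + x.2 • ω := rfl

lemma coordMap_injective {ω : F4} (hω : ω ^ 2 = ω + 1) : Function.Injective (coordMap ω) := by
  have h0 : ω ≠ 0 := by rintro rfl; simp at hω
  have h1 : 1 + ω ≠ 0 := by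
    intro h
    rw [add_comm ω 1, h] at hω
    have : ω = 0 := by simpa using hω
    exact h0 this
  rw [← LinearMap.ker_eq_bot, LinearMap.ker_eq_bot']
  rintro ⟨a, b⟩ h
  rw [coordMap_apply] at h
  have hF2 : ∀ x : F2, x = 0 ∨ x = 1 := by decide
  rcases hF2 a with rfl | rfl <;> rcases hF2 b with rfl | rfl <;> simp_all

/-- The codeword with message `c`, in coordinates with respect to the basis `1, ω`. -/
def word (c : Fin 10 → F2) : Fin 9 → F2 × F2 :=
  ![(c 0, c 1), (c 2, c 3), (c 4, c 5), (c 6, c 7), (c 8, c 9),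
    (c 0 + c 1 + c 2 + c 6 + c 7 + c 8, c 0 + c 3 + c 6 + c 9),
    (c 0 + c 3 + c 4 + c 6 + c 7 + c 9, c 1 + c 2 + c 3 + c 5 + c 6 + c 8 + c 9),
    (c 0 + c 2 + c 3 + c 5 + c 8, c 1 + c 2 + c 4 + c 5 + c 9),
    (c 0 + c 4 + c 5 + c 6 + c 8, c 1 + c 4 + c 7 + c 9)]

lemma word_injective : Function.Injective word := by
  intro c d h
  have key (j : Fin 9) : word c j = word d j := congrFun h j
  have k0 := key 0
  have k1 := key 1
  have k2 := key 2
  have k3 := key 3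
  have k4 := key 4
  simp [word] at k0 k1 k2 k3 k4
  ext i
  fin_cases i <;> simp_all

lemma coordMap_comp_word (ω : F4) (c : Fin 10 → F2) :
    coordMap ω ∘ word c =
      ∑ i, c i • ![r1 ω, r2 ω, r3 ω, r4 ω, r5 ω, r6 ω, r7 ω, r8 ω, r9 ω, r10 ω] i := by
  ext j
  fin_cases j <;>
    simp [coordMap_apply, word, Fin.sum_univ_succ, r1, r2, r3, r4, r5, r6, r7, r8, r9, r10] <;>
    module

lemma mem_C49_iff (ω : F4) (v : Fin 9 → F4) :
    v ∈ C49 ω ↔ ∃ c, coordMap ω ∘ word c = v := by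
  simp only [C49, Submodule.mem_span_range_iff_exists_fun, coordMap_comp_word]

lemma wt_comp {n : ℕ} {α β : Type*} [Zero α] [Zero β] {f : α → β} (hf : Function.Injective f)
    (h0 : f 0 = 0) (x : Fin n → α) : wt (f ∘ x) = wt x := by
  simp only [wt, Function.comp_apply, ← h0, hf.ne_iff]

lemma wt_eq_card {n : ℕ} {α : Type*} [Zero α] [DecidableEq α] (x : Fin n → α) :
    wt x = (Finset.univ.filter fun i => x i ≠ 0).card := by
  rw [wt, Nat.card_eq_fintype_card, Fintype.card_subtype]

lemma card_word_weight : ∀ w : Fin 10,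
    (Finset.univ.filter fun c : Fin 10 → F2 =>
      (Finset.univ.filter fun i => word c i ≠ 0).card = (w : ℕ)).card =
      ![1, 0, 0, 0, 51, 135, 210, 318, 234, 75] w := by
  decide +kernel

theorem stmt2 (ω : F4) (hω : ω ^ 2 = ω + 1) (w : ℕ) :
    Set.ncard {v | v ∈ C49 ω ∧ wt v = w} =
      if w = 0 then 1 else if w = 4 then 51 else if w = 5 then 135 else if w = 6 then 210 else if w = 7 then 318 else if w = 8 then 234 else if w = 9 then 75 else 0 := by
  have hinj := coordMap_injective hω
  have himage : {v | v ∈ C49 ω ∧ wt v = w} =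
      (fun c => coordMap ω ∘ word c) '' {c | wt (word c) = w} := by
    ext v
    simp only [Set.mem_ofPred_eq, Set.mem_image, mem_C49_iff]
    constructor
    · rintro ⟨⟨c, rfl⟩, h⟩
      exact ⟨c, by rwa [wt_comp hinj (map_zero _)] at h, rfl⟩
    · rintro ⟨c, h, rfl⟩
      exact ⟨⟨c, rfl⟩, by rwa [wt_comp hinj (map_zero _)]⟩
  have hcode : Function.Injective fun c => coordMap ω ∘ word c :=
    hinj.comp_left.comp word_injective
  rw [himage, Set.ncard_image_of_injective _ hcode]
  by_cases hw : w < 10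
  · have hcard := card_word_weight ⟨w, hw⟩
    simp only [← wt_eq_card] at hcard
    rw [← Set.ncard_coe_finset, Finset.coe_filter_univ] at hcard
    rw [hcard]
    interval_cases w <;> rfl
  · have hempty : {c | wt (word c) = w} = ∅ := by
      refine Set.eq_empty_of_forall_notMem fun c hc => hw ?_
      rw [← show wt (word c) = w from hc, wt_eq_card]
      exact Nat.lt_succ_of_le (Finset.card_le_univ _)
    rw [hempty, Set.ncard_empty]
    split_ifs <;> omega
end
end

section
/- The binary code C_O^36 is an optimal [36,19,8] linear code: the 19 listed generating vectors are linearly independent over GF(2) (so C_O^36 has dimension 19 as a GF(2)-subspace of GF(2)^36), every nonzero element of C_O^36 has Hamming weight at least 8, and some element has Hamming weight exactly 8. -/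
open Matrix
open scoped Classical

noncomputable section

/-- φ : GF(4) → GF(2)⁴ with φ(0)=0000, φ(1)=0011, φ(ω)=0101, φ(ω̄)=0110. -/
def phi (ω : F4) (x : F4) : Fin 4 → F2 :=
  if x = 0 then ![0, 0, 0, 0]
  else if x = 1 then ![0, 0, 1, 1]
  else if x = ω then ![0, 1, 0, 1]
  else ![0, 1, 1, 0]

/-- Φ applies φ to each coordinate and concatenates. -/
def Phi (ω : F4) (v : Fin 9 → F4) : Fin 36 → F2 := fun j =>
  phi ω (v ⟨j.val / 4, by have := j.isLt; omega⟩) ⟨j.val % 4, by omega⟩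

/-- u i (for i = 0, …, 7, corresponding to u_(i+1)) has ones exactly in the eight
positions 4(i+1)-3, …, 4(i+1)+4 (1-indexed). -/
def u (i : Fin 8) : Fin 36 → F2 := fun j =>
  if 4 * i.val ≤ j.val ∧ j.val < 4 * i.val + 8 then 1 else 0

/-- (1,0,0,0) repeated 9 times. -/
def d1 : Fin 36 → F2 := fun j => if j.val % 4 = 0 then 1 else 0

/-- (1,0,0,0) repeated 8 times followed by (0,1,1,1). -/
def d2 : Fin 36 → F2 := fun j =>
  if j.val < 32 then (if j.val % 4 = 0 then 1 else 0)
  else (if j.val % 4 = 0 then 0 else 1)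

def gensO36 (ω : F4) : Fin 19 → Fin 36 → F2 :=
  ![Phi ω (r1 ω), Phi ω (r2 ω), Phi ω (r3 ω), Phi ω (r4 ω), Phi ω (r5 ω),
    Phi ω (r6 ω), Phi ω (r7 ω), Phi ω (r8 ω), Phi ω (r9 ω), Phi ω (r10 ω),
    u 0, u 1, u 2, u 3, u 4, u 5, u 6, u 7, d1]

def CO36 (ω : F4) : Submodule F2 (Fin 36 → F2) :=
  Submodule.span F2 (Set.range (gensO36 ω))

/-- The coefficients of `1` in the coordinates of the codeword of the additive code with
coefficient vector `c`. -/
def oneCoords (c : Fin 10 → F2) : Fin 9 → F2 :=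
  ![c 0, c 2, c 4, c 6, c 8,
    c 0 + c 1 + c 2 + c 6 + c 7 + c 8,
    c 0 + c 3 + c 4 + c 6 + c 7 + c 9,
    c 0 + c 2 + c 3 + c 5 + c 8,
    c 0 + c 4 + c 5 + c 6 + c 8]

/-- The coefficients of `ω` in the coordinates of the codeword of the additive code with
coefficient vector `c`. -/
def omegaCoords (c : Fin 10 → F2) : Fin 9 → F2 :=
  ![c 1, c 3, c 5, c 7, c 9,
    c 0 + c 3 + c 6 + c 9,
    c 1 + c 2 + c 3 + c 5 + c 6 + c 8 + c 9,
    c 1 + c 2 + c 4 + c 5 + c 9,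
    c 1 + c 4 + c 7 + c 9]

/-- The value of `∑ i, b i • u i` on each of the nine blocks of length four. -/
def blockShift (b : Fin 8 → F2) : Fin 9 → F2 :=
  ![b 0, b 0 + b 1, b 1 + b 2, b 2 + b 3, b 3 + b 4, b 4 + b 5, b 5 + b 6, b 6 + b 7, b 7]

/-- The decomposition of the 36 coordinates into nine blocks of length four. -/
def blockEquiv : Fin 9 × Fin 4 ≃ Fin 36 := finProdFinEquiv

/-- A block of length four of a codeword. -/
def block (p q s t : F2) : Fin 4 → F2 := ![s + t, p + s, q + s, p + q + s]

/-- The element of `F2` given by a bit. -/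
def ofBit (x : Bool) : F2 := bif x then 1 else 0

theorem ofBit_add (x y : Bool) : ofBit x + ofBit y = ofBit (x ^^ y) := by
  revert x y
  decide

theorem ofBit_ne_zero (x : Bool) : ofBit x ≠ 0 ↔ x = true := by
  revert x
  decide

theorem val_ofBit (x : Bool) : (ofBit x).val = x.toNat := by
  revert x
  decide

theorem ite_ne_zero (x : F2) : (if x ≠ 0 then 1 else 0) = x.val := by
  revert x
  decide

theorem ite_ne_zero_or (x y : F2) : (if x ≠ 0 ∨ y ≠ 0 then 1 else 0) = max x.val y.val := by
  revert x y
  decide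

theorem exists_eq_ofBit {ι : Type*} (c : ι → F2) : ∃ d : ι → Bool, c = fun i => ofBit (d i) := by
  have h : ∀ x : F2, ∃ y, x = ofBit y := by decide
  choose f hf using h
  exact ⟨fun i => f (c i), funext fun i => hf (c i)⟩

theorem four_le_card_support_coords (c : Fin 10 → F2) (hc : c ≠ 0) :
    4 ≤ (Finset.univ.filter fun k => omegaCoords c k ≠ 0 ∨ oneCoords c k ≠ 0).card := by
  obtain ⟨d, rfl⟩ := exists_eq_ofBit c
  have h : ∃ i, d i = true := by
    simpa only [Function.ne_iff, Pi.zero_apply, ofBit_ne_zero] using hc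
  simp [Fin.exists_fin_succ] at h
  simp only [← Bool.or_eq_true] at h
  simp only [Finset.card_filter, ite_ne_zero_or, Fin.sum_univ_succ, Finset.univ_eq_empty,
    Finset.sum_empty, omegaCoords, oneCoords, ofBit_add, Matrix.cons_val_zero, Matrix.cons_val_succ,
    val_ofBit]
  generalize d 0 = x0, d 1 = x1, d 2 = x2, d 3 = x3, d 4 = x4, d 5 = x5, d 6 = x6, d 7 = x7,
    d 8 = x8, d 9 = x9 at h ⊢
  clear hc
  revert x0 x1 x2 x3 x4 x5 x6 x7 x8 x9
  decide +kernel

theorem two_le_card_support_blockShift (b : Fin 8 → F2) (hb : b ≠ 0) :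
    2 ≤ (Finset.univ.filter fun k => blockShift b k ≠ 0).card := by
  obtain ⟨d, rfl⟩ := exists_eq_ofBit b
  have h : ∃ i, d i = true := by
    simpa only [Function.ne_iff, Pi.zero_apply, ofBit_ne_zero] using hb
  simp [Fin.exists_fin_succ] at h
  simp only [← Bool.or_eq_true] at h
  simp only [Finset.card_filter, ite_ne_zero, Fin.sum_univ_succ, Finset.univ_eq_empty,
    Finset.sum_empty, blockShift, ofBit_add, Matrix.cons_val_zero, Matrix.cons_val_succ, val_ofBit]
  generalize d 0 = x0, d 1 = x1, d 2 = x2, d 3 = x3, d 4 = x4, d 5 = x5, d 6 = x6, d 7 = x7 at h ⊢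
  clear hb
  revert x0 x1 x2 x3 x4 x5 x6 x7
  decide +kernel

theorem wt_eq_sum {n : ℕ} {α : Type*} [Zero α] [DecidableEq α] (v : Fin n → α) :
    wt v = ∑ i, if v i ≠ 0 then 1 else 0 := by
  rw [wt, Nat.card_eq_fintype_card, Fintype.card_subtype, Finset.card_filter]

theorem wt_eq_sum_blocks {α : Type*} [Zero α] [DecidableEq α] (v : Fin 36 → α) :
    wt v = ∑ k : Fin 9, wt fun j : Fin 4 => v (blockEquiv (k, j)) := by
  simp only [wt_eq_sum]
  rw [← Fintype.sum_prod_type' (f := fun (k : Fin 9) (j : Fin 4) =>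
    if v (blockEquiv (k, j)) ≠ 0 then 1 else 0)]
  exact (Equiv.sum_comp blockEquiv fun i => if v i ≠ 0 then 1 else 0).symm

theorem one_le_wt_block (p q s : F2) : 1 ≤ wt (block p q s 1) := by
  rw [wt_eq_sum]
  revert p q s
  decide +kernel

theorem two_le_wt_block (p q s : F2) (h : p ≠ 0 ∨ q ≠ 0) : 2 ≤ wt (block p q s 0) := by
  rw [wt_eq_sum]
  revert p q s
  decide +kernel

theorem wt_block_one : wt (block 0 0 1 0) = 4 := by
  rw [wt_eq_sum]
  decide +kernel

theorem Phi_apply (ω : F4) (v : Fin 9 → F4) (k : Fin 9) (j : Fin 4) :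
    Phi ω v (blockEquiv (k, j)) = phi ω (v k) j := by
  have hk : (blockEquiv (k, j)).val / 4 = k := by simp [blockEquiv, finProdFinEquiv]; omega
  have hj : (blockEquiv (k, j)).val % 4 = j := by simp [blockEquiv, finProdFinEquiv]
  simp only [Phi, hk, hj]

theorem u_apply (i : Fin 8) (k : Fin 9) (j : Fin 4) :
    u i (blockEquiv (k, j)) = if k = i.castSucc ∨ k = i.succ then 1 else 0 := by
  revert i k j
  decide +kernel

theorem d1_apply (k : Fin 9) (j : Fin 4) :
    d1 (blockEquiv (k, j)) = if j = 0 then 1 else 0 := by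
  revert k j
  decide +kernel

theorem wt_u_zero : wt (u 0) = 8 := by
  rw [wt_eq_sum]
  decide +kernel

theorem omega_ne_zero {ω : F4} (hω : ω ^ 2 = ω + 1) : ω ≠ 0 := by
  rintro rfl
  simp at hω

theorem omega_ne_one {ω : F4} (hω : ω ^ 2 = ω + 1) : ω ≠ 1 := by
  rintro rfl
  simp at hω

theorem omega_add_one_ne_zero {ω : F4} (hω : ω ^ 2 = ω + 1) : ω + 1 ≠ 0 :=
  hω ▸ pow_ne_zero 2 (omega_ne_zero hω)

theorem phi_omega {ω : F4} (hω : ω ^ 2 = ω + 1) : phi ω ω = ![0, 1, 0, 1] := by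
  simp [phi, omega_ne_zero hω, omega_ne_one hω]

theorem phi_omega_add_one {ω : F4} (hω : ω ^ 2 = ω + 1) : phi ω (ω + 1) = ![0, 1, 1, 0] := by
  simp [phi, omega_ne_zero hω, omega_add_one_ne_zero hω]

/-- The blocks of a codeword in terms of its coefficient vector. -/
theorem sum_gensO36_apply {ω : F4} (hω : ω ^ 2 = ω + 1) (a : Fin 19 → F2) (k : Fin 9) :
    (fun j => (∑ i, a i • gensO36 ω i) (blockEquiv (k, j))) =
      block (omegaCoords (fun i => a (i.castLE (by omega))) k)
        (oneCoords (fun i => a (i.castLE (by omega))) k)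
        (blockShift (fun i => a ((i.natAdd 10).castSucc)) k) (a 18) := by
  have h0 : phi ω 0 = ![0, 0, 0, 0] := if_pos rfl
  have h1 : phi ω 1 = ![0, 0, 1, 1] := by simp [phi]
  have h2 := phi_omega hω
  have h3 := phi_omega_add_one hω
  have htwo : (2 : F2) = 0 := rfl
  funext j
  simp [gensO36, Fin.sum_univ_succ, Phi_apply, u_apply, d1_apply]
  fin_cases k <;> simp [r1, r2, r3, r4, r5, r6, r7, r8, r9, r10, h0, h1, h2, h3,
      block, omegaCoords, oneCoords, blockShift]
  all_goals fin_cases j <;> simp <;> ring_nf <;> simp [htwo]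

theorem eight_le_wt_sum_gensO36 {ω : F4} (hω : ω ^ 2 = ω + 1) (a : Fin 19 → F2) (ha : a ≠ 0) :
    8 ≤ wt (∑ i, a i • gensO36 ω i) := by
  rw [wt_eq_sum_blocks]
  simp only [sum_gensO36_apply hω]
  set c : Fin 10 → F2 := fun i => a (i.castLE (by omega))
  set b : Fin 8 → F2 := fun i => a ((i.natAdd 10).castSucc)
  by_cases ht : a 18 = 0
  · by_cases hc0 : c = 0
    · have hb0 : b ≠ 0 := by
        intro hb0
        refine ha (funext fun i => ?_)
        induction i using Fin.lastCases with
        | last => exact ht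
        | cast i =>
          induction i using Fin.addCases (m := 10) (n := 8) with
          | left i => exact congrFun hc0 i
          | right i => exact congrFun hb0 i
      calc 8 = 2 * 4 := rfl
        _ ≤ (Finset.univ.filter fun k => blockShift b k ≠ 0).card * 4 :=
          Nat.mul_le_mul_right _ (two_le_card_support_blockShift b hb0)
        _ = ∑ k, if blockShift b k ≠ 0 then 4 else 0 := by
          rw [← Finset.sum_filter, Finset.sum_const, smul_eq_mul]
        _ ≤ _ := Finset.sum_le_sum fun k _ => by
          split_ifs with hk
          · have hp : omegaCoords c k = 0 := by rw [hc0]; clear * -; revert k; decide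
            have hq : oneCoords c k = 0 := by rw [hc0]; clear * -; revert k; decide
            rw [hp, hq, ht, Fin.eq_one_of_ne_zero _ hk]
            exact wt_block_one.ge
          · exact Nat.zero_le _
    · calc 8 = 4 * 2 := rfl
        _ ≤ (Finset.univ.filter fun k => omegaCoords c k ≠ 0 ∨ oneCoords c k ≠ 0).card * 2 :=
          Nat.mul_le_mul_right _ (four_le_card_support_coords c hc0)
        _ = ∑ k, if omegaCoords c k ≠ 0 ∨ oneCoords c k ≠ 0 then 2 else 0 := by
          rw [← Finset.sum_filter, Finset.sum_const, smul_eq_mul]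
        _ ≤ _ := Finset.sum_le_sum fun k _ => by
          split_ifs with hk
          · rw [ht]
            exact two_le_wt_block _ _ _ hk
          · exact Nat.zero_le _
  · rw [Fin.eq_one_of_ne_zero _ ht]
    calc 8 ≤ ∑ _k : Fin 9, 1 := by simp
      _ ≤ _ := Finset.sum_le_sum fun k _ => one_le_wt_block _ _ _

theorem linearIndependent_gensO36 {ω : F4} (hω : ω ^ 2 = ω + 1) :
    LinearIndependent F2 (gensO36 ω) := by
  refine Fintype.linearIndependent_iff.2 fun a h => ?_
  by_contra! ha
  have h8 := eight_le_wt_sum_gensO36 hω a (Function.ne_iff.2 ha)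
  rw [h] at h8
  simp [wt] at h8

theorem stmt8 (ω : F4) (hω : ω ^ 2 = ω + 1) :
    LinearIndependent F2 (gensO36 ω) ∧
    Module.finrank F2 (CO36 ω) = 19 ∧
    (∀ v ∈ CO36 ω, v ≠ 0 → 8 ≤ wt v) ∧ (∃ v ∈ CO36 ω, wt v = 8) := by
  refine ⟨linearIndependent_gensO36 hω, ?_, fun v hv hv0 => ?_, u 0, ?_, wt_u_zero⟩
  · exact (finrank_span_eq_card (linearIndependent_gensO36 hω)).trans (Fintype.card_fin 19)
  · obtain ⟨a, rfl⟩ := (Submodule.mem_span_range_iff_exists_fun F2).1 hv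
    refine eight_le_wt_sum_gensO36 hω a ?_
    rintro rfl
    simp at hv0
  · exact Submodule.subset_span ⟨10, rfl⟩
end
end

section
/- The binary codes C_O^36 and C_E^36 are inequivalent: there is no permutation σ of the coordinate set {1, …, 36} such that the image of C_O^36 under permuting coordinates by σ equals C_E^36. -/
open Matrix
open scoped Classical

noncomputable section

def gensE36 (ω : F4) : Fin 19 → Fin 36 → F2 :=
  ![Phi ω (r1 ω), Phi ω (r2 ω), Phi ω (r3 ω), Phi ω (r4 ω), Phi ω (r5 ω),
    Phi ω (r6 ω), Phi ω (r7 ω), Phi ω (r8 ω), Phi ω (r9 ω), Phi ω (r10 ω),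
    u 0, u 1, u 2, u 3, u 4, u 5, u 6, u 7, d2]

def CE36 (ω : F4) : Submodule F2 (Fin 36 → F2) :=
  Submodule.span F2 (Set.range (gensE36 ω))

/-- The elements of GF(4), indexed in the order `0, 1, ω, ω + 1`. -/
def symbol (ω : F4) : Fin 4 → F4 := ![0, 1, ω, ω + 1]

/-- The generators `r1, …, r10`, with entries given by their index in `symbol`. -/
def quaternaryRow : Fin 10 → Fin 9 → Fin 4 :=
  ![![1, 0, 0, 0, 0, 3, 1, 1, 1], ![2, 0, 0, 0, 0, 1, 2, 2, 2],
    ![0, 1, 0, 0, 0, 1, 2, 3, 0], ![0, 2, 0, 0, 0, 2, 3, 1, 0],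
    ![0, 0, 1, 0, 0, 0, 1, 2, 3], ![0, 0, 2, 0, 0, 0, 2, 3, 1],
    ![0, 0, 0, 1, 0, 3, 3, 0, 1], ![0, 0, 0, 2, 0, 1, 1, 0, 2],
    ![0, 0, 0, 0, 1, 1, 2, 1, 1], ![0, 0, 0, 0, 2, 2, 3, 2, 2]]

/-- The images of `0, 1, ω, ω + 1` under `phi ω`. -/
def phiSymbol : Fin 4 → Fin 4 → F2 :=
  ![![0, 0, 0, 0], ![0, 0, 1, 1], ![0, 1, 0, 1], ![0, 1, 1, 0]]

/-- The binary images `Phi ω (r1 ω), …, Phi ω (r10 ω)`. -/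
def binaryRow (i : Fin 10) : Fin 36 → F2 := fun j =>
  phiSymbol (quaternaryRow i ⟨j.val / 4, by have := j.isLt; omega⟩) ⟨j.val % 4, by omega⟩

/-- The generators common to both codes, followed by `d`. -/
def codeGens (d : Fin 36 → F2) : Fin (10 + 8 + 1) → Fin 36 → F2 :=
  Fin.snoc (Fin.append binaryRow u) d

theorem phi_symbol {ω : F4} (hω : ω ^ 2 = ω + 1) (k : Fin 4) :
    phi ω (symbol ω k) = phiSymbol k := by
  have h2 : (1 : F4) + 1 = 0 := CharTwo.add_self_eq_zero 1
  have h0 : ω ≠ 0 := by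
    rintro rfl
    simp at hω
  have h1 : ω ≠ 1 := by
    rintro rfl
    simp [h2] at hω
  have h3 : ω + 1 ≠ 0 := by
    rw [← hω]
    exact pow_ne_zero 2 h0
  fin_cases k <;> simp [phi, symbol, phiSymbol, h0, h1, h3]

theorem Phi_symbol {ω : F4} (hω : ω ^ 2 = ω + 1) {v : Fin 9 → F4} {i : Fin 10}
    (hv : v = fun j => symbol ω (quaternaryRow i j)) : Phi ω v = binaryRow i := by
  subst hv
  funext j
  simp only [Phi, binaryRow, phi_symbol hω]

theorem gens_eq_codeGens {ω : F4} (hω : ω ^ 2 = ω + 1) (d : Fin 36 → F2) :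
    ![Phi ω (r1 ω), Phi ω (r2 ω), Phi ω (r3 ω), Phi ω (r4 ω), Phi ω (r5 ω),
      Phi ω (r6 ω), Phi ω (r7 ω), Phi ω (r8 ω), Phi ω (r9 ω), Phi ω (r10 ω),
      u 0, u 1, u 2, u 3, u 4, u 5, u 6, u 7, d] = codeGens d := by
  have aux (v : Fin 9 → F4) (i : Fin 10)
      (hv : ∀ j, v j = symbol ω (quaternaryRow i j)) : Phi ω v = binaryRow i :=
    Phi_symbol hω (funext hv)
  rw [aux (r1 ω) 0 (by intro j; fin_cases j <;> rfl),
    aux (r2 ω) 1 (by intro j; fin_cases j <;> rfl),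
    aux (r3 ω) 2 (by intro j; fin_cases j <;> rfl),
    aux (r4 ω) 3 (by intro j; fin_cases j <;> rfl),
    aux (r5 ω) 4 (by intro j; fin_cases j <;> rfl),
    aux (r6 ω) 5 (by intro j; fin_cases j <;> rfl),
    aux (r7 ω) 6 (by intro j; fin_cases j <;> rfl),
    aux (r8 ω) 7 (by intro j; fin_cases j <;> rfl),
    aux (r9 ω) 8 (by intro j; fin_cases j <;> rfl),
    aux (r10 ω) 9 (by intro j; fin_cases j <;> rfl)]
  funext i
  fin_cases i <;> rfl

theorem mem_span_codeGens {d v : Fin 36 → F2} :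
    v ∈ Submodule.span F2 (Set.range (codeGens d)) ↔
      ∃ (a : Fin 10 → F2) (b : Fin 8 → F2) (e : F2),
        v = ∑ i, a i • binaryRow i + ∑ i, b i • u i + e • d := by
  rw [Submodule.mem_span_range_iff_exists_fun]
  constructor
  · rintro ⟨x, rfl⟩
    refine ⟨fun i => x (Fin.castSucc (Fin.castAdd 8 i)),
      fun i => x (Fin.castSucc (Fin.natAdd 10 i)), x (Fin.last _), ?_⟩
    simp only [codeGens, Fin.sum_univ_castSucc (n := 10 + 8), Fin.sum_univ_add, Fin.snoc_castSucc,
      Fin.snoc_last, Fin.append_left, Fin.append_right]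
  · rintro ⟨a, b, e, rfl⟩
    refine ⟨Fin.snoc (Fin.append a b) e, ?_⟩
    simp only [codeGens, Fin.sum_univ_castSucc (n := 10 + 8), Fin.sum_univ_add, Fin.snoc_castSucc,
      Fin.snoc_last, Fin.append_left, Fin.append_right]

/-- The inverse of the Gram matrix of `binaryRow`. -/
def gramInv : Matrix (Fin 10) (Fin 10) F2 :=
  !![0, 1, 0, 1, 1, 0, 0, 1, 1, 1;
     1, 0, 1, 0, 1, 1, 1, 0, 0, 1;
     0, 1, 0, 0, 1, 1, 1, 1, 1, 0;
     1, 0, 0, 0, 0, 1, 0, 1, 1, 1;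
     1, 1, 1, 0, 0, 0, 0, 0, 1, 1;
     0, 1, 1, 1, 0, 0, 0, 0, 0, 1;
     0, 1, 1, 0, 0, 0, 0, 1, 1, 1;
     1, 0, 1, 1, 0, 0, 1, 0, 0, 1;
     1, 0, 1, 1, 1, 0, 1, 0, 0, 1;
     1, 1, 0, 1, 1, 1, 1, 1, 1, 0]

theorem gram_mul_gramInv :
    (Matrix.of fun i j => binaryRow i ⬝ᵥ binaryRow j) * gramInv = 1 := by
  decide +kernel

theorem u_dotProduct_binaryRow : ∀ i j, u i ⬝ᵥ binaryRow j = 0 := by decide +kernel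

theorem one_dotProduct_binaryRow : ∀ i, 1 ⬝ᵥ binaryRow i = 0 := by decide +kernel

theorem one_dotProduct_u : ∀ i, 1 ⬝ᵥ u i = 0 := by decide +kernel

theorem d1_dotProduct_binaryRow : ∀ i, d1 ⬝ᵥ binaryRow i = 0 := by decide +kernel

theorem binaryRow_dotProduct_d1 : ∀ i, binaryRow i ⬝ᵥ d1 = 0 := by decide +kernel

theorem u_dotProduct_d1 : ∀ i, u i ⬝ᵥ d1 = 0 := by decide +kernel

theorem d1_dotProduct_d1 : d1 ⬝ᵥ d1 = 1 := by decide +kernel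

theorem one_dotProduct_d1 : 1 ⬝ᵥ d1 = 1 := by decide +kernel

theorem d2_dotProduct_binaryRow : ∀ i, d2 ⬝ᵥ binaryRow i = 0 := by decide +kernel

theorem d2_dotProduct_u : ∀ i, d2 ⬝ᵥ u i = 0 := by decide +kernel

theorem d2_dotProduct_d2 : d2 ⬝ᵥ d2 = 1 := by decide +kernel

theorem one_dotProduct_d2 : 1 ⬝ᵥ d2 = 1 := by decide +kernel

/-- `d2` is a characteristic vector of its code. -/
theorem d2_dotProduct_of_mem {c : Fin 36 → F2}
    (hc : c ∈ Submodule.span F2 (Set.range (codeGens d2))) : d2 ⬝ᵥ c = 1 ⬝ᵥ c := by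
  obtain ⟨a, b, e, rfl⟩ := mem_span_codeGens.1 hc
  simp only [dotProduct_add, dotProduct_sum, dotProduct_smul, d2_dotProduct_binaryRow,
    d2_dotProduct_u, d2_dotProduct_d2, one_dotProduct_binaryRow, one_dotProduct_u,
    one_dotProduct_d2]

/-- The characteristic vectors of the code generated by `d1` form the coset of `d1` modulo the
span of `u`. -/
theorem eq_of_characteristic {v : Fin 36 → F2}
    (hv : v ∈ Submodule.span F2 (Set.range (codeGens d1)))
    (h : ∀ c ∈ Submodule.span F2 (Set.range (codeGens d1)), v ⬝ᵥ c = 1 ⬝ᵥ c) :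
    ∃ b : Fin 8 → F2, v = ∑ i, b i • u i + d1 := by
  obtain ⟨a, b, e, rfl⟩ := mem_span_codeGens.1 hv
  have hrow (i : Fin 10) : binaryRow i ∈ Submodule.span F2 (Set.range (codeGens d1)) :=
    mem_span_codeGens.2 ⟨Pi.single i 1, 0, 0, by simp [Pi.single_apply]⟩
  have hd : d1 ∈ Submodule.span F2 (Set.range (codeGens d1)) :=
    mem_span_codeGens.2 ⟨0, 0, 1, by simp⟩
  have he : e = 1 := by
    have hvd := h d1 hd
    simp only [add_dotProduct, sum_dotProduct, smul_dotProduct, binaryRow_dotProduct_d1,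
      u_dotProduct_d1, d1_dotProduct_d1, one_dotProduct_d1, mul_zero, Finset.sum_const_zero,
      zero_add, smul_eq_mul, mul_one] at hvd
    exact hvd
  have ha : a ᵥ* (Matrix.of fun i j => binaryRow i ⬝ᵥ binaryRow j) = 0 := by
    funext j
    have hvj := h _ (hrow j)
    simp only [add_dotProduct, sum_dotProduct, smul_dotProduct, u_dotProduct_binaryRow,
      d1_dotProduct_binaryRow, one_dotProduct_binaryRow, mul_zero, Finset.sum_const_zero,
      add_zero, smul_eq_mul] at hvj
    simp only [Matrix.vecMul_eq_sum, Finset.sum_apply, Pi.smul_apply, Matrix.of_apply,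
      smul_eq_mul, Pi.zero_apply]
    exact hvj
  have ha0 : a = 0 := by
    rw [← Matrix.vecMul_one a, ← gram_mul_gramInv, ← Matrix.vecMul_vecMul, ha,
      Matrix.zero_vecMul]
  exact ⟨b, by simp [ha0, he]⟩

theorem card_support_span_u_add_d1 : ∀ b : Fin 8 → F2,
    (Finset.univ.filter fun j => (∑ i, b i * u i j) + d1 j ≠ 0).card % 4 = 1 := by
  decide +kernel

theorem card_support_d2 : (Finset.univ.filter fun j => d2 j ≠ 0).card = 11 := by
  decide +kernel

theorem stmt10 (ω : F4) (hω : ω ^ 2 = ω + 1) :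
    ¬ ∃ σ : Equiv.Perm (Fin 36),
      (fun v : Fin 36 → F2 => fun i => v (σ i)) '' (CO36 ω : Set (Fin 36 → F2)) =
        (CE36 ω : Set (Fin 36 → F2)) := by
  rintro ⟨σ, hσ⟩
  have hO : CO36 ω = Submodule.span F2 (Set.range (codeGens d1)) := by
    rw [CO36, gensO36, gens_eq_codeGens hω]
  have hE : CE36 ω = Submodule.span F2 (Set.range (codeGens d2)) := by
    rw [CE36, gensE36, gens_eq_codeGens hω]
  rw [hO, hE] at hσ
  have hd2 : d2 ∈ Submodule.span F2 (Set.range (codeGens d2)) :=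
    mem_span_codeGens.2 ⟨0, 0, 1, by simp⟩
  obtain ⟨v, hv, hvd⟩ := hσ.ge hd2
  have hdot (w c : Fin 36 → F2) : (fun i => w (σ i)) ⬝ᵥ (fun i => c (σ i)) = w ⬝ᵥ c :=
    Equiv.sum_comp σ fun i => w i * c i
  obtain ⟨b, hb⟩ := eq_of_characteristic hv fun c hc => by
    rw [← hdot v c, ← hdot 1 c]
    exact (congrArg (· ⬝ᵥ _) hvd).trans (d2_dotProduct_of_mem (hσ.le ⟨c, hc, rfl⟩))
  have hcard : (Finset.univ.filter fun j => d2 j ≠ 0).card =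
      (Finset.univ.filter fun j => v j ≠ 0).card :=
    Finset.card_equiv σ fun i => by simp [← hvd]
  have hmod := card_support_span_u_add_d1 b
  have hv' : ∀ j, v j = (∑ i, b i * u i j) + d1 j := fun j => by
    simp [hb, Finset.sum_apply]
  simp only [← hv'] at hmod
  rw [card_support_d2] at hcard
  omega
end
end
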